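/- Fix 0 < α, β < 1 and n ∈ ℕ. Then the following two subsets of the maximal domain D_max^{J,n} coincide: B_n = { f ∈ D_max^{J,n} : lim_{x→1⁻}[f,P_j^{(α,β)}]_n(x) = 0 and lim_{x→-1⁺}[f,P_j^{(α,β)}]_n(x) = 0 for all j = 0, …, n-1 } and F_n = { f ∈ D_max^{J,n} : for every j = 1, …, n, lim_{x→1⁻} ( d^{j-1}/dx^{j-1} )[ (1-x)^{α+j}(1+x)^{β+j} f^{(j)}(x) ] = 0 and lim_{x→-1⁺} ( d^{j-1}/dx^{j-1} )[ (1-x)^{α+j}(1+x)^{β+j} f^{(j)}(x) ] = 0 }. In particular the left-definite domain admits the non-GKN description F_n by explicit endpoint limits of weighted derivatives. -/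

import Mathlib

open MeasureTheory Set Filter Topology

/-- Membership in the weighted space `L²_{α,β}(-1,1)`. -/
def MemL2ab (α β : ℝ) (f : ℝ → ℂ) : Prop :=
  IntegrableOn (fun x : ℝ => ‖f x‖ ^ 2 * (1 - x) ^ α * (1 + x) ^ β) (Ioo (-1 : ℝ) 1)

/-- The Jacobi differential expression
`ℓ_{α,β}[f](x) = -(1-x)^{-α}(1+x)^{-β}·[(1-x)^{α+1}(1+x)^{β+1} f'(x)]'`. -/
noncomputable def jacobiL (α β : ℝ) (f : ℝ → ℂ) : ℝ → ℂ := fun x =>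
  -((((1 - x) ^ (-α) * (1 + x) ^ (-β) : ℝ) : ℂ) *
    deriv (fun y : ℝ => (((1 - y) ^ (α + 1) * (1 + y) ^ (β + 1) : ℝ) : ℂ) * deriv f y) x)

/-- The maximal domain `D_max^{J,n}` of the `n`-th power of the Jacobi expression:
`C^{2n}` functions on `(-1,1)` with `f ∈ L²_{α,β}` and `ℓ^n_{α,β}[f] ∈ L²_{α,β}`. -/
def JacobiMaxDom (α β : ℝ) (n : ℕ) (f : ℝ → ℂ) : Prop :=
  ContDiffOn ℝ (2 * n) f (Ioo (-1 : ℝ) 1) ∧ MemL2ab α β f ∧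
    MemL2ab α β ((jacobiL α β)^[n] f)

/-- The coefficient function `a_k(x) = (1-x)^{α+k}(1+x)^{β+k}`. -/
noncomputable def ak (α β : ℝ) (k : ℕ) (x : ℝ) : ℝ :=
  (1 - x) ^ (α + (k : ℝ)) * (1 + x) ^ (β + (k : ℝ))

/-- The `n`-th Jacobi sesquilinear form (for real-valued `g`; no conjugation):
`[f,g]_n(x) = Σ_{k=1}^{n} Σ_{j=1}^{k} (-1)^{k+j} { (a_k g^{(k)})^{(k-j)} f^{(j-1)}
 − (a_k f^{(k)})^{(k-j)} g^{(j-1)} }`. -/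
noncomputable def sesq (α β : ℝ) (n : ℕ) (f g : ℝ → ℂ) (x : ℝ) : ℂ :=
  ∑ k ∈ Finset.Icc 1 n, ∑ j ∈ Finset.Icc 1 k, (-1 : ℂ) ^ (k + j) *
    (iteratedDeriv (k - j) (fun y => ((ak α β k y : ℝ) : ℂ) * iteratedDeriv k g y) x *
        iteratedDeriv (j - 1) f x -
      iteratedDeriv (k - j) (fun y => ((ak α β k y : ℝ) : ℂ) * iteratedDeriv k f y) x *
        iteratedDeriv (j - 1) g x)

/-- The rising Pochhammer symbol `(a)_r = a(a+1)⋯(a+r-1)`. -/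
noncomputable def poch (a : ℝ) (r : ℕ) : ℝ := ∏ i ∈ Finset.range r, (a + i)

/-- The `m`-th Jacobi polynomial
`P_m^{(α,β)}(x) = Σ_{j=0}^{m} (-1/2)^j ((m+α+β+1)_j (α+j+1)_{m-j}) / (j!(m-j)!) (1-x)^j`. -/
noncomputable def jacobiP (α β : ℝ) (m : ℕ) (x : ℝ) : ℝ :=
  ∑ j ∈ Finset.range (m + 1),
    (-(1 : ℝ) / 2) ^ j *
      (poch ((m : ℝ) + α + β + 1) j * poch (α + (j : ℝ) + 1) (m - j)) /
      ((j.factorial : ℝ) * ((m - j).factorial : ℝ)) * (1 - x) ^ j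


/-- The linear coefficient `a(1+x) - b(1-x)`. -/
def sx (a b x : ℝ) : ℝ := a * (1 + x) - b * (1 - x)

/-- A L'Hôpital-type lemma at a regular singular point. -/
lemma key_limit (p q : ℝ) (hp : 0 < p) (H H' : ℝ → ℂ)
    (hd : ∀ x ∈ Ioo (-1 : ℝ) 1, HasDerivAt H (H' x) x) (L : ℂ)
    (hr : Tendsto (fun x : ℝ => ((1 - x ^ 2 : ℝ) : ℂ) * H' x + ((sx p q x : ℝ) : ℂ) * H x)
      (𝓝[<] (1 : ℝ)) (𝓝 L)) :
    Tendsto H (𝓝[<] (1 : ℝ)) (𝓝 (L / (2 * p : ℝ))) := by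
  set M : ℂ := L / (2 * p : ℝ) with hM
  have hL : L = M * ((2 * p : ℝ) : ℂ) := by
    have : ((2 * p : ℝ) : ℂ) ≠ 0 := by
      rw [Complex.ofReal_ne_zero]; positivity
    rw [hM]; field_simp
  set D : ℝ → ℝ := fun x => (1 - x) ^ (-p) * (1 + x) ^ (-q) with hD
  have hDpos : ∀ x ∈ Ioo (-1 : ℝ) 1, 0 < D x := by
    intro x hx
    have h1 : 0 < 1 - x := by linarith [hx.2]
    have h2 : 0 < 1 + x := by linarith [hx.1]
    positivity
  have hDd : ∀ x ∈ Ioo (-1 : ℝ) 1, HasDerivAt D (sx p q x / (1 - x ^ 2) * D x) x := by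
    intro x hx
    have h1 : 0 < 1 - x := by linarith [hx.2]
    have h2 : 0 < 1 + x := by linarith [hx.1]
    have e1 : HasDerivAt (fun x : ℝ => 1 - x) (-1) x := by
      simpa using (hasDerivAt_id x).const_sub 1
    have e2 : HasDerivAt (fun x : ℝ => 1 + x) 1 x := by
      simpa using (hasDerivAt_id x).const_add 1
    have := (e1.rpow_const (p := -p) (Or.inl h1.ne')).mul
      (e2.rpow_const (p := -q) (Or.inl h2.ne'))
    refine this.congr_deriv ?_
    rw [Real.rpow_sub_one h1.ne', Real.rpow_sub_one h2.ne']
    have h3 : (1 - x ^ 2) = (1 - x) * (1 + x) := by ring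
    rw [h3]
    simp only [hD, sx]
    field_simp
    ring
  have hsx : Tendsto (fun x => sx p q x) (𝓝[<] (1 : ℝ)) (𝓝 (2 * p)) := by
    have : ContinuousAt (fun x => sx p q x) 1 := by unfold sx; fun_prop
    have h := this.tendsto
    have e : sx p q 1 = 2 * p := by unfold sx; ring
    rw [e] at h
    exact h.mono_left nhdsWithin_le_nhds
  have hDtop : Tendsto D (𝓝[<] (1 : ℝ)) atTop := by
    have a1 : Tendsto (fun x : ℝ => (1 - x) ^ (-p)) (𝓝[<] (1 : ℝ)) atTop := by
      have : Tendsto (fun x : ℝ => 1 - x) (𝓝[<] (1 : ℝ)) (𝓝[>] 0) := by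
        rw [tendsto_nhdsWithin_iff]
        constructor
        · have : ContinuousAt (fun x : ℝ => 1 - x) 1 := by fun_prop
          have h := this.tendsto
          simp only [sub_self] at h
          exact h.mono_left nhdsWithin_le_nhds
        · filter_upwards [self_mem_nhdsWithin] with x hx
          have : x < 1 := hx
          simpa using this
      exact (tendsto_rpow_neg_nhdsGT_zero (by linarith)).comp this
    have a2 : Tendsto (fun x : ℝ => (1 + x) ^ (-q)) (𝓝[<] (1 : ℝ)) (𝓝 ((1 + 1) ^ (-q))) := by
      have : ContinuousAt (fun x : ℝ => (1 + x) ^ (-q)) 1 := by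
        apply ContinuousAt.rpow_const (by fun_prop)
        left; norm_num
      exact this.tendsto.mono_left nhdsWithin_le_nhds
    exact a1.atTop_mul_pos (by positivity) a2
  rw [Metric.tendsto_nhds]
  intro ε hε
  have hR : Tendsto (fun x : ℝ => ‖((1 - x ^ 2 : ℝ) : ℂ) * H' x + ((sx p q x : ℝ) : ℂ) * H x
      - M * ((sx p q x : ℝ) : ℂ)‖ - ε / 2 * sx p q x) (𝓝[<] (1 : ℝ)) (𝓝 (-(ε * p))) := by
    have h1 := ((hr.sub (((Complex.continuous_ofReal.tendsto _).comp hsx).const_mul M)).norm).sub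
      (hsx.const_mul (ε / 2))
    have e : ‖L - M * ((2 * p : ℝ) : ℂ)‖ - ε / 2 * (2 * p) = -(ε * p) := by
      rw [hL, sub_self, norm_zero]; ring
    rw [e] at h1
    exact h1
  have hev1 := hR.eventually (gt_mem_nhds (show -(ε * p) < 0 by nlinarith))
  have hall := hev1.and (Ioo_mem_nhdsLT (show (0 : ℝ) < 1 by norm_num))
  obtain ⟨l, hl, hsub⟩ := (mem_nhdsLT_iff_exists_Ioo_subset' (show (0 : ℝ) < 1 by norm_num)).1 hall
  set x0 : ℝ := (l + 1) / 2 with hx0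
  have hl1 : l < 1 := hl
  have hx0l : l < x0 := by rw [hx0]; linarith
  have hx01 : x0 < 1 := by rw [hx0]; linarith
  have hbd : ∀ x ∈ Ico x0 1, ‖(H x - M) * ((D x : ℝ) : ℂ)‖
      ≤ ‖(H x0 - M) * ((D x0 : ℝ) : ℂ)‖ + ε / 2 * (D x - D x0) := by
    intro x hx
    have hin : ∀ y ∈ Icc x0 x, y ∈ Ioo (-1 : ℝ) 1 ∧
        ‖((1 - y ^ 2 : ℝ) : ℂ) * H' y + ((sx p q y : ℝ) : ℂ) * H y
      - M * ((sx p q y : ℝ) : ℂ)‖ - ε / 2 * sx p q y < 0 := by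
      intro y hy
      have := hsub (show y ∈ Ioo l 1 from ⟨by linarith [hy.1], by linarith [hy.2, hx.2]⟩)
      exact ⟨⟨by linarith [this.2.1], this.2.2⟩, this.1⟩
    have hKd : ∀ y ∈ Icc x0 x, HasDerivAt (fun x => (H x - M) * ((D x : ℝ) : ℂ))
        (H' y * ((D y : ℝ) : ℂ) + (H y - M) * ((sx p q y / (1 - y ^ 2) * D y : ℝ) : ℂ)) y := by
      intro y hy
      exact ((hd y (hin y hy).1).sub_const M).mul (hDd y (hin y hy).1).ofReal_comp
    have hBd : ∀ y ∈ Icc x0 x, HasDerivAt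
        (fun x => ‖(H x0 - M) * ((D x0 : ℝ) : ℂ)‖ + ε / 2 * (D x - D x0))
        (ε / 2 * (sx p q y / (1 - y ^ 2) * D y)) y := by
      intro y hy
      exact (((hDd y (hin y hy).1).sub_const _).const_mul _).const_add _
    refine image_norm_le_of_norm_deriv_right_le_deriv_boundary'
      (f := fun x => (H x - M) * ((D x : ℝ) : ℂ))
      (fun y hy => (hKd y hy).continuousAt.continuousWithinAt)
      (fun y hy => (hKd y (Ico_subset_Icc_self hy)).hasDerivWithinAt) ?_
      (fun y hy => (hBd y hy).continuousAt.continuousWithinAt)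
      (fun y hy => (hBd y (Ico_subset_Icc_self hy)).hasDerivWithinAt) ?_
      (right_mem_Icc.2 hx.1)
    · simp
    · intro y hy
      obtain ⟨hy1, hy2⟩ := hin y (Ico_subset_Icc_self hy)
      have hq : 0 < 1 - y ^ 2 := by nlinarith [hy1.1, hy1.2]
      have hDy := hDpos y hy1
      have e : H' y * ((D y : ℝ) : ℂ) + (H y - M) * ((sx p q y / (1 - y ^ 2) * D y : ℝ) : ℂ)
          = ((D y / (1 - y ^ 2) : ℝ) : ℂ) * (((1 - y ^ 2 : ℝ) : ℂ) * H' y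
            + ((sx p q y : ℝ) : ℂ) * H y - M * ((sx p q y : ℝ) : ℂ)) := by
        have : ((1 - y ^ 2 : ℝ) : ℂ) ≠ 0 := by
          rw [Complex.ofReal_ne_zero]; exact hq.ne'
        generalize D y = d
        rw [Complex.ofReal_mul, Complex.ofReal_div, Complex.ofReal_div]
        field_simp
        ring
      rw [e, norm_mul, Complex.norm_real, Real.norm_of_nonneg (by positivity)]
      have : ε / 2 * (sx p q y / (1 - y ^ 2) * D y)
        = D y / (1 - y ^ 2) * (ε / 2 * sx p q y) := by field_simp
      rw [this]
      exact mul_le_mul_of_nonneg_left (by linarith) (by positivity)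
  have hev2 := hDtop.eventually_gt_atTop
    ((‖(H x0 - M) * ((D x0 : ℝ) : ℂ)‖ + ε / 2 * |D x0|) / (ε / 2))
  filter_upwards [hev2, Ioo_mem_nhdsLT hx01, Ioo_mem_nhdsLT (show (-1 : ℝ) < 1 by norm_num)]
    with x h1 h2 h3
  have h4 := hbd x ⟨h2.1.le, h2.2⟩
  have hDx := hDpos x h3
  rw [norm_mul, Complex.norm_real, Real.norm_of_nonneg hDx.le] at h4
  rw [div_lt_iff₀ (by positivity)] at h1
  rw [dist_eq_norm]
  have h5 : -(D x0) ≤ |D x0| := neg_le_abs _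
  have h6 : ‖H x - M‖ * D x < ε * D x := by nlinarith
  exact lt_of_mul_lt_mul_right h6 hDx.le

lemma limit_of_integrable (F F' : ℝ → ℂ)
    (hd : ∀ x ∈ Ioo (-1 : ℝ) 1, HasDerivAt F (F' x) x)
    (hi : IntegrableOn F' (Ioo 0 1)) : ∃ L, Tendsto F (𝓝[<] (1 : ℝ)) (𝓝 L) := by
  have hi' : IntervalIntegrable F' volume 0 1 := by
    rw [intervalIntegrable_iff_integrableOn_Ioo_of_le (by norm_num)]; exact hi
  have hc := intervalIntegral.continuousOn_primitive_interval' hi' (left_mem_uIcc)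
  have h1 : ContinuousWithinAt (fun b => ∫ x in (0:ℝ)..b, F' x) (uIcc 0 1) 1 := hc 1 right_mem_uIcc
  rw [uIcc_of_le (by norm_num)] at h1
  have h2 : Tendsto (fun b => ∫ x in (0:ℝ)..b, F' x) (𝓝[<] (1:ℝ))
      (𝓝 (∫ x in (0:ℝ)..1, F' x)) := by
    have := h1.mono_of_mem_nhdsWithin (s := Iio 1)
      (mem_of_superset (Ioo_mem_nhdsLT (show (0:ℝ) < 1 by norm_num)) Ioo_subset_Icc_self)
    exact this.tendsto
  refine ⟨_, (h2.const_add (F 0)).congr' ?_⟩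
  filter_upwards [Ioo_mem_nhdsLT (show (0:ℝ) < 1 by norm_num)] with x hx
  have : ∫ y in (0:ℝ)..x, F' y = F x - F 0 := by
    apply intervalIntegral.integral_eq_sub_of_hasDerivAt
    · intro y hy
      rw [uIcc_of_le hx.1.le] at hy
      exact hd y ⟨by linarith [hy.1], by linarith [hy.2, hx.2]⟩
    · apply hi'.mono_set
      rw [uIcc_of_le hx.1.le, uIcc_of_le (by norm_num)]
      exact Icc_subset_Icc_right hx.2.le
  rw [this]; ring

lemma integrable_of_limit (F : ℝ → ℂ) (hc : ContinuousOn F (Ioo (-1 : ℝ) 1)) (L : ℂ)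
    (hL : Tendsto F (𝓝[<] (1 : ℝ)) (𝓝 L)) : IntegrableOn F (Ioo 0 1) := by
  have h0 : Tendsto F (𝓝[>] (0:ℝ)) (𝓝 (F 0)) := by
    have : ContinuousAt F 0 := hc.continuousAt (Ioo_mem_nhds (by norm_num) (by norm_num))
    exact this.tendsto.mono_left nhdsWithin_le_nhds
  have h1 := continuousOn_Icc_extendFrom_Ioo (hc.mono (Ioo_subset_Ioo_left (by norm_num))) h0 hL
  have h2 := h1.integrableOn_Icc (μ := volume)
  refine (h2.mono_set Ioo_subset_Icc_self).congr_fun ?_ measurableSet_Ioo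
  intro x hx
  exact extendFrom_extends (hc.mono (Ioo_subset_Ioo_left (by norm_num))) x hx

lemma integrableOn_comp_neg_iff_aux (F : ℝ → ℂ) (a b : ℝ) :
    IntegrableOn (fun x => F (-x)) (Ioo a b) ↔ IntegrableOn F (Ioo (-b) (-a)) := by
  have h := (Measure.measurePreserving_neg (volume : Measure ℝ)).integrableOn_comp_preimage
    (MeasurableEquiv.neg ℝ).measurableEmbedding (f := F) (s := Ioo (-b) (-a))
  rw [← h]
  simp [Function.comp_def]

/-- The system of functions `G k m = (a_k f^{(k)})^{(m)}`, `W i = w ℓ^i f` with its relations. -/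
structure JSys (α β : ℝ) (n : ℕ) (G : ℕ → ℕ → ℝ → ℂ) (W W' Y : ℕ → ℝ → ℂ) : Prop where
  hd : ∀ k m, k + m < 2 * n → ∀ x ∈ Ioo (-1 : ℝ) 1, HasDerivAt (G k m) (G k (m + 1) x) x
  hrec : ∀ k m, k + 1 + m ≤ 2 * n → ∀ x ∈ Ioo (-1 : ℝ) 1,
    G (k + 1) m x = ((1 - x ^ 2 : ℝ) : ℂ) * G k (m + 1) x
      + ((sx (α + k - m) (β + k - m) x : ℝ) : ℂ) * G k m x
      + ((m * (α + β + 2 * k - m + 1) : ℝ) : ℂ) * G k (m - 1) x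
  h0 : ∀ x ∈ Ioo (-1 : ℝ) 1, G 0 0 x = W 0 x
  hW : ∀ i < n, ∀ x ∈ Ioo (-1 : ℝ) 1, HasDerivAt (W i) (W' i x) x
  hY : ∀ i < n, ∀ x ∈ Ioo (-1 : ℝ) 1,
    Y i x = ((1 - x ^ 2 : ℝ) : ℂ) * W' i x + ((sx α β x : ℝ) : ℂ) * W i x
  hYd : ∀ i < n, ∀ x ∈ Ioo (-1 : ℝ) 1, HasDerivAt (Y i) (-W (i + 1) x) x
  hinteg : IntegrableOn (W n) (Ioo (-1 : ℝ) 1)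

lemma JSys.reflect {α β : ℝ} {n : ℕ} {G : ℕ → ℕ → ℝ → ℂ} {W W' Y : ℕ → ℝ → ℂ}
    (S : JSys α β n G W W' Y) :
    JSys β α n (fun k m x => (-1) ^ (k + m) * G k m (-x)) (fun i x => W i (-x))
      (fun i x => -W' i (-x)) (fun i x => -Y i (-x)) := by
  have hneg : ∀ x ∈ Ioo (-1 : ℝ) 1, -x ∈ Ioo (-1 : ℝ) 1 := fun x hx =>
    ⟨by linarith [hx.2], by linarith [hx.1]⟩
  have hcomp : ∀ (F : ℝ → ℂ) (F' : ℂ) (x : ℝ), HasDerivAt F F' (-x) →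
      HasDerivAt (fun y => F (-y)) (-F') x := by
    intro F F' x h
    exact (h.scomp x (hasDerivAt_neg x)).congr_deriv (by simp)
  refine ⟨?_, ?_, ?_, ?_, ?_, ?_, ?_⟩
  · intro k m hkm x hx
    refine ((hcomp _ _ x (S.hd k m hkm (-x) (hneg x hx))).const_mul _).congr_deriv ?_
    ring
  · intro k m hkm x hx
    rw [S.hrec k m hkm (-x) (hneg x hx)]
    rcases m with _ | m
    · unfold sx
      push_cast
      ring
    · unfold sx
      push_cast
      ring
  · intro x hx
    simpa using S.h0 (-x) (hneg x hx)
  · intro i hi x hx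
    exact hcomp _ _ x (S.hW i hi (-x) (hneg x hx))
  · intro i hi x hx
    rw [S.hY i hi (-x) (hneg x hx)]
    unfold sx
    push_cast
    ring
  · intro i hi x hx
    exact ((hcomp _ _ x (S.hYd i hi (-x) (hneg x hx))).neg).congr_deriv (by ring)
  · have := S.hinteg
    have h2 := (integrableOn_comp_neg_iff_aux (W n) (-1) 1).2
    exact h2 (by simpa using this)

lemma JSys.W_limit {α β : ℝ} {n : ℕ} {G : ℕ → ℕ → ℝ → ℂ} {W W' Y : ℕ → ℝ → ℂ}
    (S : JSys α β n G W W' Y) (hα : 0 < α) :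
    ∀ i ≤ n, IntegrableOn (W i) (Ioo 0 1) := by
  intro i hi
  induction hi using Nat.decreasingInduction with
  | self => exact S.hinteg.mono_set (Ioo_subset_Ioo_left (by norm_num))
  | of_succ i hi ih =>
    obtain ⟨L, hL⟩ := limit_of_integrable (Y i) _ (S.hYd i hi) ih.neg
    have h1 : Tendsto (fun x : ℝ => ((1 - x ^ 2 : ℝ) : ℂ) * W' i x
        + ((sx α β x : ℝ) : ℂ) * W i x) (𝓝[<] (1 : ℝ)) (𝓝 L) := by
      refine hL.congr' ?_
      filter_upwards [Ioo_mem_nhdsLT (show (-1 : ℝ) < 1 by norm_num)] with x hx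
      exact S.hY i hi x hx
    have h2 := key_limit α β hα (W i) (W' i) (S.hW i hi) L h1
    exact integrable_of_limit _
      (fun x hx => (S.hW i hi x hx).continuousAt.continuousWithinAt) _ h2

lemma JSys.diag {α β : ℝ} {n : ℕ} {G : ℕ → ℕ → ℝ → ℂ} {W W' Y : ℕ → ℝ → ℂ}
    (S : JSys α β n G W W' Y) :
    ∀ k ≤ n, ∃ c : ℕ → ℂ, ∀ x ∈ Ioo (-1 : ℝ) 1,
      G k k x = ∑ i ∈ Finset.range (k + 1), c i * W i x := by
  intro k
  induction k with
  | zero =>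
    intro _
    refine ⟨fun _ => 1, fun x hx => ?_⟩
    simpa using S.h0 x hx
  | succ k ih =>
    intro hk
    obtain ⟨c, hc⟩ := ih (by omega)
    have hev : ∀ x ∈ Ioo (-1 : ℝ) 1, ∀ᶠ y in 𝓝 x, y ∈ Ioo (-1 : ℝ) 1 := fun x hx =>
      isOpen_Ioo.mem_nhds hx
    have hlt : ∀ i ∈ Finset.range (k + 1), i < n := fun i hi => by
      have := Finset.mem_range.1 hi; omega
    have h1 : ∀ x ∈ Ioo (-1 : ℝ) 1,
        G k (k + 1) x = ∑ i ∈ Finset.range (k + 1), c i * W' i x := by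
      intro x hx
      have a1 := S.hd k k (by omega) x hx
      have a2 : HasDerivAt (fun x => ∑ i ∈ Finset.range (k + 1), c i * W i x)
          (∑ i ∈ Finset.range (k + 1), c i * W' i x) x :=
        HasDerivAt.fun_sum fun i hi => (S.hW i (hlt i hi) x hx).const_mul (c i)
      have a3 := a2.congr_of_eventuallyEq ((hev x hx).mono fun y hy => hc y hy)
      exact a1.unique a3
    have h2 : ∀ x ∈ Ioo (-1 : ℝ) 1,
        ((1 - x ^ 2 : ℝ) : ℂ) * G k (k + 1) x + ((sx α β x : ℝ) : ℂ) * G k k x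
          = ∑ i ∈ Finset.range (k + 1), c i * Y i x := by
      intro x hx
      rw [h1 x hx, hc x hx, Finset.mul_sum, Finset.mul_sum, ← Finset.sum_add_distrib]
      refine Finset.sum_congr rfl fun i hi => ?_
      rw [S.hY i (hlt i hi) x hx]
      ring
    have h3 : ∀ x ∈ Ioo (-1 : ℝ) 1,
        ((1 - x ^ 2 : ℝ) : ℂ) * G k (k + 2) x + ((sx α β x - 2 * x : ℝ) : ℂ) * G k (k + 1) x
          + ((α + β : ℝ) : ℂ) * G k k x
          = ∑ i ∈ Finset.range (k + 1), c i * (-W (i + 1) x) := by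
      intro x hx
      have b1 : HasDerivAt (fun x : ℝ => ((1 - x ^ 2 : ℝ) : ℂ)) ((-(2 * x) : ℝ) : ℂ) x := by
        apply HasDerivAt.ofReal_comp
        simpa using ((hasDerivAt_pow 2 x).const_sub 1)
      have b2 : HasDerivAt (fun x : ℝ => ((sx α β x : ℝ) : ℂ)) ((α + β : ℝ) : ℂ) x := by
        apply HasDerivAt.ofReal_comp
        unfold sx
        refine ((((hasDerivAt_id x).const_add 1).const_mul α).sub
          (((hasDerivAt_id x).const_sub 1).const_mul β)).congr_deriv ?_
        ring
      have a1 := (b1.mul (S.hd k (k + 1) (by omega) x hx)).add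
        (b2.mul (S.hd k k (by omega) x hx))
      have a2 : HasDerivAt (fun x => ∑ i ∈ Finset.range (k + 1), c i * Y i x)
          (∑ i ∈ Finset.range (k + 1), c i * (-W (i + 1) x)) x :=
        HasDerivAt.fun_sum fun i hi => (S.hYd i (hlt i hi) x hx).const_mul (c i)
      have a3 := a2.congr_of_eventuallyEq ((hev x hx).mono fun y hy => h2 y hy)
      rw [← a1.unique a3]
      push_cast
      ring
    refine ⟨fun i => (if i = 0 then 0 else -c (i - 1))
      + (if i = k + 1 then 0 else ((k * (α + β + k + 1) : ℝ) : ℂ) * c i), fun x hx => ?_⟩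
    have e1 : G (k + 1) (k + 1) x
        = ∑ i ∈ Finset.range (k + 1), c i * (-W (i + 1) x)
          + ((k * (α + β + k + 1) : ℝ) : ℂ) * ∑ i ∈ Finset.range (k + 1), c i * W i x := by
      rw [S.hrec k (k + 1) (by omega) x hx, ← h3 x hx, ← hc x hx]
      simp only [Nat.add_sub_cancel]
      unfold sx
      push_cast
      ring
    rw [e1]
    simp only [add_mul, Finset.sum_add_distrib]
    congr 1
    · rw [Finset.sum_range_succ' _ (k + 1)]
      simp
    · rw [Finset.sum_range_succ _ (k + 1), Finset.mul_sum]
      simp only [if_true, zero_mul, add_zero]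
      refine Finset.sum_congr rfl fun i hi => ?_
      have : i ≠ k + 1 := by have := Finset.mem_range.1 hi; omega
      rw [if_neg this]; ring

lemma JSys.top_limit {α β : ℝ} {n : ℕ} {G : ℕ → ℕ → ℝ → ℂ} {W W' Y : ℕ → ℝ → ℂ}
    (S : JSys α β n G W W' Y) (hα : 0 < α) :
    ∀ m < n, ∃ L, Tendsto (G n m) (𝓝[<] (1 : ℝ)) (𝓝 L) := by
  have key : ∀ m ≤ n, IntegrableOn (G n m) (Ioo 0 1) := by
    intro m hm
    induction hm using Nat.decreasingInduction with
    | self =>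
      obtain ⟨c, hc⟩ := S.diag n le_rfl
      have : IntegrableOn (fun x => ∑ i ∈ Finset.range (n + 1), c i * W i x) (Ioo 0 1) := by
        apply integrable_finsetSum
        intro i hi
        exact (S.W_limit hα i (by have := Finset.mem_range.1 hi; omega)).const_mul _
      refine this.congr_fun ?_ measurableSet_Ioo
      intro x hx
      exact (hc x ⟨by linarith [hx.1], hx.2⟩).symm
    | of_succ m hm ih =>
      obtain ⟨L, hL⟩ := limit_of_integrable (G n m) _ (S.hd n m (by omega)) ih
      exact integrable_of_limit _
        (fun x hx => (S.hd n m (by omega) x hx).continuousAt.continuousWithinAt) _ hL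
  intro m hm
  exact limit_of_integrable (G n m) _ (S.hd n m (by omega)) (key (m + 1) hm)

lemma tendsto_one_sub_sq : Tendsto (fun x : ℝ => ((1 - x ^ 2 : ℝ) : ℂ)) (𝓝[<] (1 : ℝ)) (𝓝 0) := by
  have : ContinuousAt (fun x : ℝ => ((1 - x ^ 2 : ℝ) : ℂ)) 1 := by fun_prop
  have h := this.tendsto
  simp only [one_pow, sub_self, Complex.ofReal_zero] at h
  exact h.mono_left nhdsWithin_le_nhds

lemma tendsto_sx (a b : ℝ) : Tendsto (fun x : ℝ => ((sx a b x : ℝ) : ℂ)) (𝓝[<] (1 : ℝ))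
    (𝓝 ((2 * a : ℝ) : ℂ)) := by
  have : ContinuousAt (fun x : ℝ => ((sx a b x : ℝ) : ℂ)) 1 := by unfold sx; fun_prop
  have h := this.tendsto
  have e : sx a b 1 = 2 * a := by unfold sx; ring
  rw [e] at h
  exact h.mono_left nhdsWithin_le_nhds

lemma JSys.limits {α β : ℝ} {n : ℕ} {G : ℕ → ℕ → ℝ → ℂ} {W W' Y : ℕ → ℝ → ℂ}
    (S : JSys α β n G W W' Y) (hα : 0 < α) :
    ∃ γ : ℕ → ℕ → ℂ, (∀ k ≤ n, ∀ m ≤ k, m < n → Tendsto (G k m) (𝓝[<] (1 : ℝ)) (𝓝 (γ k m))) ∧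
      ∀ k < n, ∀ m ≤ k, γ (k + 1) m = ((2 * (α + k - m) : ℝ) : ℂ) * γ k m
        + ((m * (α + β + 2 * k - m + 1) : ℝ) : ℂ) * γ k (m - 1) := by
  have hI := Ioo_mem_nhdsLT (show (-1 : ℝ) < 1 by norm_num)
  -- existence, together with the equation in the limit
  have step : ∀ k < n, ∀ m ≤ k, ∀ L L' : ℂ, Tendsto (G (k + 1) m) (𝓝[<] (1 : ℝ)) (𝓝 L) →
      (m ≠ 0 → Tendsto (G k (m - 1)) (𝓝[<] (1 : ℝ)) (𝓝 L')) →
      Tendsto (G k m) (𝓝[<] (1 : ℝ)) (𝓝 ((L - ((m * (α + β + 2 * k - m + 1) : ℝ) : ℂ) * L')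
        / ((2 * (α + k - m) : ℝ) : ℂ))) := by
    intro k hk m hm L L' hL hL'
    have hmk : (m : ℝ) ≤ k := by exact_mod_cast hm
    apply key_limit (α + k - m) (β + k - m) (by linarith) (G k m) (G k (m + 1))
      (S.hd k m (by omega))
    have h1 : Tendsto (fun x => ((m * (α + β + 2 * k - m + 1) : ℝ) : ℂ) * G k (m - 1) x)
        (𝓝[<] (1 : ℝ)) (𝓝 (((m * (α + β + 2 * k - m + 1) : ℝ) : ℂ) * L')) := by
      by_cases h : m = 0
      · subst h; simp
      · exact (hL' h).const_mul _
    refine (hL.sub h1).congr' ?_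
    filter_upwards [hI] with x hx
    rw [S.hrec k m (by omega) x hx]
    ring
  have ex : ∀ k ≤ n, ∀ m ≤ k, m < n → ∃ L, Tendsto (G k m) (𝓝[<] (1 : ℝ)) (𝓝 L) := by
    intro k hk
    induction hk using Nat.decreasingInduction with
    | self => exact fun m _ hm => S.top_limit hα m hm
    | of_succ k hk ih =>
      intro m
      induction m with
      | zero =>
        intro _ _
        obtain ⟨L, hL⟩ := ih 0 (by omega) (by omega)
        exact ⟨_, step k hk 0 (by omega) L 0 hL (fun h => absurd rfl h)⟩
      | succ m ihm =>
        intro h1 h2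
        obtain ⟨L, hL⟩ := ih (m + 1) (by omega) (by omega)
        obtain ⟨L', hL'⟩ := ihm (by omega) (by omega)
        exact ⟨_, step k hk (m + 1) h1 L L' hL (fun _ => hL')⟩
  choose! γ hγ using ex
  refine ⟨γ, hγ, fun k hk m hm => ?_⟩
  have hmk : (m : ℝ) ≤ k := by exact_mod_cast hm
  have h1 := step k hk m hm _ (γ k (m - 1)) (hγ (k + 1) (by omega) m (by omega) (by omega))
    (fun h => hγ k hk.le (m - 1) (by omega) (by omega))
  have h2 := tendsto_nhds_unique (hγ k hk.le m hm (by omega)) h1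
  have h3 : ((2 * (α + k - m) : ℝ) : ℂ) ≠ 0 := by
    rw [Complex.ofReal_ne_zero]
    have : 0 < α + k - m := by linarith
    positivity
  rw [h2]
  field_simp
  ring

lemma JSys.limits_left {α β : ℝ} {n : ℕ} {G : ℕ → ℕ → ℝ → ℂ} {W W' Y : ℕ → ℝ → ℂ}
    (S : JSys α β n G W W' Y) (hβ : 0 < β) :
    ∃ γ : ℕ → ℕ → ℂ, (∀ k ≤ n, ∀ m ≤ k, m < n → Tendsto (G k m) (𝓝[>] (-1 : ℝ)) (𝓝 (γ k m))) ∧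
      ∀ k < n, ∀ m ≤ k, γ (k + 1) m = ((-(2 * (β + k - m)) : ℝ) : ℂ) * γ k m
        + ((m * (α + β + 2 * k - m + 1) : ℝ) : ℂ) * γ k (m - 1) := by
  obtain ⟨γ, h1, h2⟩ := S.reflect.limits hβ
  refine ⟨fun k m => (-1) ^ (k + m) * γ k m, ?_, ?_⟩
  · intro k hk m hm hmn
    have h := ((h1 k hk m hm hmn).const_mul ((-1) ^ (k + m))).comp
      (show Tendsto (fun x : ℝ => -x) (𝓝[>] (-1 : ℝ)) (𝓝[<] (1 : ℝ)) by
        simpa using tendsto_neg_nhdsGT (a := (-1 : ℝ)))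
    refine h.congr fun x => ?_
    simp only [Function.comp, neg_neg]
    rw [← mul_assoc, ← mul_pow]; simp
  · intro k hk m hm
    dsimp only
    rw [h2 k hk m hm]
    rcases m with _ | m
    · push_cast
      ring
    · push_cast
      ring

/-- Algebra: the conditions `F` force all limits to vanish. -/
lemma alg_F {n : ℕ} {γ : ℕ → ℕ → ℂ} {e c : ℕ → ℕ → ℂ}
    (hrec : ∀ k < n, ∀ m ≤ k, γ (k + 1) m = e k m * γ k m + c k m * γ k (m - 1))
    (hF : ∀ k, 1 ≤ k → k ≤ n → γ k (k - 1) = 0) : ∀ k ≤ n, ∀ m < k, γ k m = 0 := by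
  intro k
  induction k with
  | zero => intro _ m hm; omega
  | succ k ih =>
    intro hk m hm
    by_cases h : m = k
    · subst h; exact hF (m + 1) (by omega) hk
    · rw [hrec k (by omega) m (by omega), ih (by omega) m (by omega),
        ih (by omega) (m - 1) (by omega)]
      ring

/-- Algebra: the conditions `B` force all limits to vanish. -/
lemma alg_B {n : ℕ} {γ : ℕ → ℕ → ℂ} {e c : ℕ → ℕ → ℂ}
    (hrec : ∀ k < n, ∀ m ≤ k, γ (k + 1) m = e k m * γ k m + c k m * γ k (m - 1))
    (he : ∀ k m, m ≤ k → e k m ≠ 0) (hc : ∀ k, c k 0 = 0)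
    (hB : ∀ j, 1 ≤ j → j ≤ n → ∑ k ∈ Finset.Icc j n, (-1 : ℂ) ^ (k + j) * γ k (k - j) = 0) :
    ∀ m, ∀ k ≤ n, m < k → γ k m = 0 := by
  intro m
  induction m using Nat.strong_induction_on with
  | _ m ih =>
    by_cases hmn : m < n
    swap
    · intro k hk hm; omega
    have htop : γ n m = 0 := by
      have h := hB (n - m) (by omega) (by omega)
      rw [Finset.sum_eq_single n] at h
      · rw [show n - (n - m) = m by omega] at h
        simpa using h
      · intro k hk hkn
        rw [Finset.mem_Icc] at hk
        rw [ih (k - (n - m)) (by omega) k hk.2 (by omega), mul_zero]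
      · intro h'; exact absurd (Finset.mem_Icc.2 ⟨by omega, le_rfl⟩) h'
    intro k hk
    induction hk using Nat.decreasingInduction with
    | self => exact fun _ => htop
    | of_succ k hk ihk =>
      intro hm
      have h := hrec k hk m hm.le
      rw [ihk (by omega)] at h
      have h0 : c k m * γ k (m - 1) = 0 := by
        by_cases h : m = 0
        · subst h; rw [hc, zero_mul]
        · rw [ih (m - 1) (by omega) k hk.le (by omega), mul_zero]
      rw [h0, add_zero] at h
      exact (mul_eq_zero.1 h.symm).resolve_left (he k m hm.le)

lemma ak_hasDerivAt (α β : ℝ) (k : ℕ) {x : ℝ} (hx : x ∈ Ioo (-1 : ℝ) 1) :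
    HasDerivAt (ak α β k) (-(sx (α + k) (β + k) x / (1 - x ^ 2) * ak α β k x)) x := by
  have h1 : 0 < 1 - x := by linarith [hx.2]
  have h2 : 0 < 1 + x := by linarith [hx.1]
  have e1 : HasDerivAt (fun x : ℝ => 1 - x) (-1) x := by
    simpa using (hasDerivAt_id x).const_sub 1
  have e2 : HasDerivAt (fun x : ℝ => 1 + x) 1 x := by
    simpa using (hasDerivAt_id x).const_add 1
  have := (e1.rpow_const (p := α + k) (Or.inl h1.ne')).mul
    (e2.rpow_const (p := β + k) (Or.inl h2.ne'))
  refine this.congr_deriv ?_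
  rw [Real.rpow_sub_one h1.ne', Real.rpow_sub_one h2.ne']
  have h3 : (1 - x ^ 2) = (1 - x) * (1 + x) := by ring
  rw [h3]
  unfold ak sx
  field_simp
  ring

lemma ak_succ (α β : ℝ) (k : ℕ) {x : ℝ} (hx : x ∈ Ioo (-1 : ℝ) 1) :
    ak α β (k + 1) x = (1 - x ^ 2) * ak α β k x := by
  have h1 : 0 < 1 - x := by linarith [hx.2]
  have h2 : 0 < 1 + x := by linarith [hx.1]
  unfold ak
  push_cast
  rw [← add_assoc, ← add_assoc, Real.rpow_add_one h1.ne', Real.rpow_add_one h2.ne']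
  ring

lemma ak_pos (α β : ℝ) (k : ℕ) {x : ℝ} (hx : x ∈ Ioo (-1 : ℝ) 1) : 0 < ak α β k x := by
  have h1 : 0 < 1 - x := by linarith [hx.2]
  have h2 : 0 < 1 + x := by linarith [hx.1]
  unfold ak
  positivity

lemma rpow_contDiffOn (a b : ℝ) (N : ℕ) :
    ContDiffOn ℝ N (fun y : ℝ => (((1 - y) ^ a * (1 + y) ^ b : ℝ) : ℂ)) (Ioo (-1 : ℝ) 1) := by
  apply Complex.ofRealCLM.contDiff.comp_contDiffOn
  apply ContDiffOn.mul
  · apply ContDiffOn.rpow_const_of_ne (by fun_prop)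
    intro x hx; linarith [hx.2]
  · apply ContDiffOn.rpow_const_of_ne (by fun_prop)
    intro x hx; linarith [hx.1]

lemma iteratedDeriv_contDiffOn {F : ℝ → ℂ} {N : ℕ} (hF : ContDiffOn ℝ N F (Ioo (-1 : ℝ) 1)) :
    ∀ m r : ℕ, m + r ≤ N → ContDiffOn ℝ r (iteratedDeriv m F) (Ioo (-1 : ℝ) 1) := by
  intro m
  induction m with
  | zero =>
    intro r hr
    rw [iteratedDeriv_zero]
    exact hF.of_le (by exact_mod_cast (by omega : r ≤ N))
  | succ m ih =>
    intro r hr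
    rw [iteratedDeriv_succ]
    exact (ih (r + 1) (by omega)).deriv_of_isOpen isOpen_Ioo (by push_cast; exact le_rfl)

lemma hasDerivAt_of_contDiffOn {F : ℝ → ℂ} {N : ℕ} (hN : 1 ≤ N)
    (hF : ContDiffOn ℝ N F (Ioo (-1 : ℝ) 1)) {x : ℝ} (hx : x ∈ Ioo (-1 : ℝ) 1) :
    HasDerivAt F (deriv F x) x := by
  have h : DifferentiableOn ℝ F (Ioo (-1 : ℝ) 1) :=
    hF.differentiableOn (by have : N ≠ 0 := by omega
                            exact_mod_cast this)
  exact (h.differentiableAt (isOpen_Ioo.mem_nhds hx)).hasDerivAt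

/-- `G k m = (a_k f^{(k)})^{(m)}`. -/
noncomputable def Gf (α β : ℝ) (f : ℝ → ℂ) (k m : ℕ) (x : ℝ) : ℂ :=
  iteratedDeriv m (fun y => ((ak α β k y : ℝ) : ℂ) * iteratedDeriv k f y) x

lemma Gf_contDiffOn (α β : ℝ) {f : ℝ → ℂ} {N : ℕ} (hf : ContDiffOn ℝ N f (Ioo (-1 : ℝ) 1))
    (k m r : ℕ) (h : k + m + r ≤ N) : ContDiffOn ℝ r (Gf α β f k m) (Ioo (-1 : ℝ) 1) := by
  have h1 : ContDiffOn ℝ ((m + r : ℕ)) (fun y => ((ak α β k y : ℝ) : ℂ) * iteratedDeriv k f y)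
      (Ioo (-1 : ℝ) 1) :=
    (rpow_contDiffOn (α + k) (β + k) (m + r)).mul (iteratedDeriv_contDiffOn hf k (m + r) (by omega))
  exact iteratedDeriv_contDiffOn h1 m r le_rfl

lemma Gf_hasDerivAt (α β : ℝ) {f : ℝ → ℂ} {N : ℕ} (hf : ContDiffOn ℝ N f (Ioo (-1 : ℝ) 1))
    (k m : ℕ) (h : k + m < N) {x : ℝ} (hx : x ∈ Ioo (-1 : ℝ) 1) :
    HasDerivAt (Gf α β f k m) (Gf α β f k (m + 1) x) x := by
  have := hasDerivAt_of_contDiffOn le_rfl (Gf_contDiffOn α β hf k m 1 (by omega)) hx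
  have e : Gf α β f k (m + 1) x = deriv (Gf α β f k m) x := by
    unfold Gf
    rw [iteratedDeriv_succ]
  rw [e]; exact this

lemma Gf_rec (α β : ℝ) {f : ℝ → ℂ} {N : ℕ} (hf : ContDiffOn ℝ N f (Ioo (-1 : ℝ) 1)) (k : ℕ) :
    ∀ m, k + 1 + m ≤ N → ∀ x ∈ Ioo (-1 : ℝ) 1,
    Gf α β f (k + 1) m x = ((1 - x ^ 2 : ℝ) : ℂ) * Gf α β f k (m + 1) x
      + ((sx (α + k - m) (β + k - m) x : ℝ) : ℂ) * Gf α β f k m x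
      + ((m * (α + β + 2 * k - m + 1) : ℝ) : ℂ) * Gf α β f k (m - 1) x := by
  intro m
  induction m with
  | zero =>
    intro h x hx
    have hq : (1 - x ^ 2 : ℝ) ≠ 0 := by nlinarith [hx.1, hx.2]
    have hq' : ((1 - x ^ 2 : ℝ) : ℂ) ≠ 0 := Complex.ofReal_ne_zero.2 hq
    have h1 : HasDerivAt (iteratedDeriv k f) (iteratedDeriv (k + 1) f x) x := by
      rw [iteratedDeriv_succ]
      exact hasDerivAt_of_contDiffOn le_rfl (iteratedDeriv_contDiffOn hf k 1 (by omega)) hx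
    have h2 := ((ak_hasDerivAt α β k hx).ofReal_comp).mul h1
    have e1 : Gf α β f k (0 + 1) x
        = ((-(sx (α + k) (β + k) x / (1 - x ^ 2) * ak α β k x) : ℝ) : ℂ) * iteratedDeriv k f x
          + ((ak α β k x : ℝ) : ℂ) * iteratedDeriv (k + 1) f x := by
      unfold Gf
      rw [iteratedDeriv_succ, iteratedDeriv_zero]
      exact h2.deriv
    rw [e1]
    unfold Gf
    simp only [iteratedDeriv_zero]
    rw [ak_succ α β k hx]
    simp only [Complex.ofReal_mul, Complex.ofReal_neg, Complex.ofReal_div]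
    simp only [Nat.cast_zero, Complex.ofReal_zero, zero_mul, sub_zero, add_zero]
    field_simp
    ring
  | succ m ih =>
    intro h x hx
    have b1 : HasDerivAt (fun x : ℝ => ((1 - x ^ 2 : ℝ) : ℂ)) ((-(2 * x) : ℝ) : ℂ) x := by
      apply HasDerivAt.ofReal_comp
      simpa using ((hasDerivAt_pow 2 x).const_sub 1)
    have b2 : HasDerivAt (fun x : ℝ => ((sx (α + k - m) (β + k - m) x : ℝ) : ℂ))
        ((α + k - m + (β + k - m) : ℝ) : ℂ) x := by
      apply HasDerivAt.ofReal_comp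
      unfold sx
      refine ((((hasDerivAt_id x).const_add 1).const_mul (α + k - m)).sub
        (((hasDerivAt_id x).const_sub 1).const_mul (β + k - m))).congr_deriv ?_
      ring
    have b3 : HasDerivAt (fun x => ((m * (α + β + 2 * k - m + 1) : ℝ) : ℂ) * Gf α β f k (m - 1) x)
        (((m * (α + β + 2 * k - m + 1) : ℝ) : ℂ) * Gf α β f k m x) x := by
      rcases m with _ | m
      · simpa using hasDerivAt_const x (0 : ℂ)
      · exact (Gf_hasDerivAt α β hf k m (by omega) hx).const_mul _
    have a1 := ((b1.mul (Gf_hasDerivAt α β hf k (m + 1) (by omega) hx)).add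
      (b2.mul (Gf_hasDerivAt α β hf k m (by omega) hx))).add b3
    have a2 := a1.congr_of_eventuallyEq
      ((isOpen_Ioo.eventually_mem hx).mono fun y hy => ih (by omega) y hy)
    rw [(Gf_hasDerivAt α β hf (k + 1) m (by omega) hx).unique a2]
    simp only [Nat.add_sub_cancel]
    unfold sx
    push_cast
    ring

/-- `w ℓ^i f`. -/
noncomputable def Wf (α β : ℝ) (f : ℝ → ℂ) (i : ℕ) (x : ℝ) : ℂ :=
  ((ak α β 0 x : ℝ) : ℂ) * ((jacobiL α β)^[i] f) x

/-- `a_1 (ℓ^i f)'`. -/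
noncomputable def Yf (α β : ℝ) (f : ℝ → ℂ) (i : ℕ) (x : ℝ) : ℂ :=
  ((ak α β 1 x : ℝ) : ℂ) * deriv ((jacobiL α β)^[i] f) x

lemma iter_contDiffOn (α β : ℝ) {f : ℝ → ℂ} {N : ℕ} (hf : ContDiffOn ℝ N f (Ioo (-1 : ℝ) 1)) :
    ∀ i r : ℕ, 2 * i + r ≤ N → ContDiffOn ℝ r ((jacobiL α β)^[i] f) (Ioo (-1 : ℝ) 1) := by
  intro i
  induction i with
  | zero =>
    intro r hr
    exact hf.of_le (by exact_mod_cast (by omega : r ≤ N))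
  | succ i ih =>
    intro r hr
    rw [Function.iterate_succ_apply']
    have h1 := (ih (r + 2) (by omega)).deriv_of_isOpen (m := (r + 1 : ℕ)) isOpen_Ioo
      (by push_cast; rw [add_assoc]; norm_num)
    have h2 := ((rpow_contDiffOn (α + 1) (β + 1) (r + 1)).mul h1).deriv_of_isOpen (m := r)
      isOpen_Ioo (by push_cast; exact le_rfl)
    exact ((rpow_contDiffOn (-α) (-β) r).mul h2).neg

lemma jsys_of_maxDom {α β : ℝ} (hα : 0 < α) (hβ : 0 < β) {n : ℕ} {f : ℝ → ℂ}
    (h : JacobiMaxDom α β n f) :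
    JSys α β n (Gf α β f) (Wf α β f) (fun i => deriv (Wf α β f i)) (Yf α β f) := by
  obtain ⟨hf0, -, hL⟩ := h
  have hf : ContDiffOn ℝ ((2 * n : ℕ)) f (Ioo (-1 : ℝ) 1) := by exact_mod_cast hf0
  have hu := iter_contDiffOn α β hf
  have hud : ∀ i < n, ∀ x ∈ Ioo (-1 : ℝ) 1, HasDerivAt ((jacobiL α β)^[i] f)
      (deriv ((jacobiL α β)^[i] f) x) x := fun i hi x hx =>
    hasDerivAt_of_contDiffOn le_rfl (hu i 1 (by omega)) hx
  have hWd : ∀ i < n, ∀ x ∈ Ioo (-1 : ℝ) 1, HasDerivAt (Wf α β f i) _ x := fun i hi x hx =>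
    ((ak_hasDerivAt α β 0 hx).ofReal_comp).mul (hud i hi x hx)
  refine ⟨?_, ?_, ?_, ?_, ?_, ?_, ?_⟩
  · exact fun k m hkm x hx => Gf_hasDerivAt α β hf k m hkm hx
  · exact fun k m hkm x hx => Gf_rec α β hf k m hkm x hx
  · intro x hx
    simp [Gf, Wf]
  · intro i hi x hx
    exact (hWd i hi x hx).differentiableAt.hasDerivAt
  · intro i hi x hx
    have hq : (1 - x ^ 2 : ℝ) ≠ 0 := by nlinarith [hx.1, hx.2]
    have hq' : ((1 - x ^ 2 : ℝ) : ℂ) ≠ 0 := Complex.ofReal_ne_zero.2 hq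
    rw [(hWd i hi x hx).deriv]
    unfold Yf Wf
    rw [ak_succ α β 0 hx]
    simp only [Complex.ofReal_mul, Complex.ofReal_neg, Complex.ofReal_div, Nat.cast_zero, add_zero]
    field_simp
    ring
  · intro i hi x hx
    have h1 := (hu i 2 (by omega)).deriv_of_isOpen (m := (1 : ℕ)) isOpen_Ioo (by norm_num)
    have h2 := (rpow_contDiffOn (α + 1) (β + 1) 1).mul h1
    have h3 := hasDerivAt_of_contDiffOn le_rfl h2 hx
    have e : Yf α β f i = fun y : ℝ => (((1 - y) ^ (α + 1) * (1 + y) ^ (β + 1) : ℝ) : ℂ)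
        * deriv ((jacobiL α β)^[i] f) y := by
      funext y
      simp [Yf, ak]
    rw [e]
    refine h3.congr_deriv ?_
    unfold Wf
    rw [Function.iterate_succ_apply']
    conv_rhs => unfold jacobiL
    have p1 : 0 < 1 - x := by linarith [hx.2]
    have p2 : 0 < 1 + x := by linarith [hx.1]
    have e2 : ak α β 0 x * ((1 - x) ^ (-α) * (1 + x) ^ (-β)) = 1 := by
      unfold ak
      simp only [Nat.cast_zero, add_zero]
      rw [Real.rpow_neg p1.le, Real.rpow_neg p2.le]
      have := Real.rpow_pos_of_pos p1 α
      have := Real.rpow_pos_of_pos p2 β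
      field_simp
    rw [mul_neg, neg_neg, ← mul_assoc, ← Complex.ofReal_mul, e2, Complex.ofReal_one, one_mul]
    rfl
  · have hc : ContinuousOn (Wf α β f n) (Ioo (-1 : ℝ) 1) :=
      ((rpow_contDiffOn (α + (0 : ℕ)) (β + (0 : ℕ)) 0).mul (hu n 0 (by omega))).continuousOn
    have hw : IntegrableOn (fun x : ℝ => (1 - x) ^ α * (1 + x) ^ β) (Ioo (-1 : ℝ) 1) := by
      have : Continuous (fun x : ℝ => (1 - x) ^ α * (1 + x) ^ β) := by
        apply Continuous.mul
        · exact Continuous.rpow_const (by fun_prop) (fun x => Or.inr hα.le)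
        · exact Continuous.rpow_const (by fun_prop) (fun x => Or.inr hβ.le)
      exact (this.integrableOn_Icc (a := -1) (b := 1)).mono_set Ioo_subset_Icc_self
    refine Integrable.mono' (hw.add hL) (hc.aestronglyMeasurable measurableSet_Ioo) ?_
    refine (ae_restrict_iff' measurableSet_Ioo).2 (Eventually.of_forall fun x hx => ?_)
    have p1 : 0 < 1 - x := by linarith [hx.2]
    have p2 : 0 < 1 + x := by linarith [hx.1]
    have hp := ak_pos α β 0 hx
    unfold Wf
    rw [norm_mul, Complex.norm_real, Real.norm_of_nonneg hp.le]
    unfold ak at hp ⊢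
    simp only [Nat.cast_zero, add_zero, Pi.add_apply] at hp ⊢
    generalize ‖(jacobiL α β)^[n] f x‖ = t
    nlinarith [mul_nonneg hp.le (sq_nonneg (t - 1)), mul_nonneg hp.le (sq_nonneg t)]

open Polynomial in
lemma iteratedDeriv_poly (P : ℝ[X]) (k : ℕ) :
    iteratedDeriv k (fun x : ℝ => ((P.eval x : ℝ) : ℂ))
      = fun x : ℝ => (((derivative^[k] P).eval x : ℝ) : ℂ) := by
  induction k with
  | zero => simp
  | succ k ih =>
    rw [iteratedDeriv_succ, ih]
    funext x
    rw [Function.iterate_succ_apply']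
    exact (((derivative^[k] P).hasDerivAt x).ofReal_comp).deriv

open Polynomial in
lemma iteratedDeriv_ak_poly (α β : ℝ) (P : ℝ[X]) (k : ℕ) : ∀ i ≤ k, ∃ Q : ℝ[X],
    ∀ x ∈ Ioo (-1 : ℝ) 1,
      iteratedDeriv i (fun y : ℝ => ((ak α β k y : ℝ) : ℂ) * ((P.eval y : ℝ) : ℂ)) x
        = ((ak α β (k - i) x : ℝ) : ℂ) * ((Q.eval x : ℝ) : ℂ) := by
  intro i
  induction i with
  | zero => exact fun _ => ⟨P, fun x hx => by simp⟩
  | succ i ih =>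
    intro hi
    obtain ⟨Q, hQ⟩ := ih (by omega)
    obtain ⟨r, hr⟩ : ∃ r, k - i = r + 1 := ⟨k - i - 1, by omega⟩
    rw [hr] at hQ
    refine ⟨(1 - X ^ 2) * derivative Q - (C (α + (r + 1)) * (1 + X) - C (β + (r + 1)) * (1 - X)) * Q,
      fun x hx => ?_⟩
    have hq : (1 - x ^ 2 : ℝ) ≠ 0 := by nlinarith [hx.1, hx.2]
    rw [show k - (i + 1) = r by omega, iteratedDeriv_succ]
    have a1 := ((ak_hasDerivAt α β (r + 1) hx).mul (Q.hasDerivAt x)).ofReal_comp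
    have a2 := a1.congr_of_eventuallyEq (f₁ := iteratedDeriv i
      (fun y : ℝ => ((ak α β k y : ℝ) : ℂ) * ((P.eval y : ℝ) : ℂ)))
      ((isOpen_Ioo.eventually_mem hx).mono fun y hy => by
        rw [hQ y hy, ← Complex.ofReal_mul]; rfl)
    rw [a2.deriv, ← Complex.ofReal_mul, ak_succ α β r hx]
    congr 1
    simp only [eval_sub, eval_mul, eval_add, eval_one, eval_pow, eval_X, eval_C]
    unfold sx
    push_cast
    field_simp
    ring

/-- The Jacobi polynomial as an element of `ℝ[X]`. -/
noncomputable def JP (α β : ℝ) (m : ℕ) : Polynomial ℝ :=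
  ∑ j ∈ Finset.range (m + 1),
    Polynomial.C ((-(1 : ℝ) / 2) ^ j *
      (poch ((m : ℝ) + α + β + 1) j * poch (α + (j : ℝ) + 1) (m - j)) /
      ((j.factorial : ℝ) * ((m - j).factorial : ℝ))) * (1 - Polynomial.X) ^ j

lemma JP_eval (α β : ℝ) (m : ℕ) (x : ℝ) : (JP α β m).eval x = jacobiP α β m x := by
  unfold JP jacobiP
  rw [Polynomial.eval_finsetSum]
  refine Finset.sum_congr rfl fun j _ => ?_
  simp

lemma poch_pos {a : ℝ} (ha : 0 < a) (r : ℕ) : 0 < poch a r := by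
  unfold poch
  exact Finset.prod_pos fun i _ => by positivity

open Polynomial in
lemma coeff_one_sub_X_pow (j d : ℕ) :
    ((1 - X : ℝ[X]) ^ j).coeff d = (-1) ^ d * (j.choose d : ℝ) := by
  have h : (1 - X : ℝ[X]) ^ j = ((1 + X : ℝ[X]) ^ j).comp (C (-1) * X) := by
    simp [sub_eq_add_neg]
  rw [h, comp_C_mul_X_coeff, coeff_one_add_X_pow, mul_comm]

lemma JP_coeff (α β : ℝ) (hα : 0 < α) (hβ : 0 < β) (m : ℕ) :
    (∀ d, m < d → (JP α β m).coeff d = 0) ∧ (JP α β m).coeff m ≠ 0 := by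
  constructor
  · intro d hd
    unfold JP
    rw [Polynomial.finsetSum_coeff]
    refine Finset.sum_eq_zero fun j hj => ?_
    have := Finset.mem_range.1 hj
    rw [Polynomial.coeff_C_mul, coeff_one_sub_X_pow, Nat.choose_eq_zero_of_lt (by omega)]
    simp
  · unfold JP
    rw [Polynomial.finsetSum_coeff, Finset.sum_range_succ, Finset.sum_eq_zero, zero_add,
      Polynomial.coeff_C_mul, coeff_one_sub_X_pow, Nat.choose_self]
    · have h1 : 0 < poch ((m : ℝ) + α + β + 1) m := poch_pos (by positivity) m
      have h2 : 0 < poch (α + (m : ℝ) + 1) (m - m) := poch_pos (by positivity) _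
      have h3 : (m.factorial : ℝ) ≠ 0 := by positivity
      have h4 : ((m - m).factorial : ℝ) ≠ 0 := by positivity
      have h5 : (-(1 : ℝ) / 2) ^ m ≠ 0 := pow_ne_zero _ (by norm_num)
      have h6 : (-(1 : ℝ)) ^ m ≠ 0 := pow_ne_zero _ (by norm_num)
      simp only [Nat.cast_one, mul_one]
      exact mul_ne_zero (div_ne_zero (mul_ne_zero h5 (mul_pos h1 h2).ne') (mul_ne_zero h3 h4)) h6
    · intro j hj
      have := Finset.mem_range.1 hj
      rw [Polynomial.coeff_C_mul, coeff_one_sub_X_pow, Nat.choose_eq_zero_of_lt (by omega)]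
      simp

open Polynomial in
/-- A Taylor-type functional vanishing on the first `n` Jacobi polynomials is zero. -/
lemma functional_zero (α β : ℝ) (hα : 0 < α) (hβ : 0 < β) (n : ℕ) (e : ℝ) (b : ℕ → ℂ)
    (h : ∀ i < n, ∑ j ∈ Finset.Icc 1 n,
      b j * (((derivative^[j - 1] (JP α β i)).eval e : ℝ) : ℂ) = 0) :
    ∀ j, 1 ≤ j → j ≤ n → b j = 0 := by
  have key : ∀ d ≤ n, ∀ p : ℝ[X], (∀ i, d ≤ i → p.coeff i = 0) → ∑ j ∈ Finset.Icc 1 n,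
      b j * (((derivative^[j - 1] p).eval e : ℝ) : ℂ) = 0 := by
    intro d
    induction d with
    | zero =>
      intro _ p hp
      have : p = 0 := by ext i; simpa using hp i (by omega)
      subst this
      simp
    | succ d ih =>
      intro hd p hp
      obtain ⟨c1, c2⟩ := JP_coeff α β hα hβ d
      set a : ℝ := p.coeff d / (JP α β d).coeff d with ha
      have h1 := ih (by omega) (p - C a * JP α β d) (by
        intro i hi
        rw [coeff_sub, coeff_C_mul]
        rcases hi.eq_or_lt with rfl | hlt
        · rw [ha]; field_simp; ring
        · rw [hp i hlt, c1 i hlt]; ring)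
      have h2 := h d (by omega)
      have h3 : ∑ j ∈ Finset.Icc 1 n, b j * (((derivative^[j - 1] p).eval e : ℝ) : ℂ)
          = ∑ j ∈ Finset.Icc 1 n,
              b j * (((derivative^[j - 1] (p - C a * JP α β d)).eval e : ℝ) : ℂ)
            + (a : ℂ) * ∑ j ∈ Finset.Icc 1 n,
              b j * (((derivative^[j - 1] (JP α β d)).eval e : ℝ) : ℂ) := by
        rw [Finset.mul_sum, ← Finset.sum_add_distrib]
        refine Finset.sum_congr rfl fun j _ => ?_
        rw [iterate_derivative_sub, iterate_derivative_C_mul, eval_sub, eval_mul, eval_C]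
        push_cast
        ring
      rw [h3, h1, h2]; simp
  intro j hj1 hjn
  have h1 := key n le_rfl ((X - C e) ^ (j - 1)) (by
    intro i hi
    apply coeff_eq_zero_of_natDegree_lt
    rw [natDegree_pow, natDegree_X_sub_C]
    omega)
  rw [Finset.sum_eq_single j] at h1
  · rw [iterate_derivative_X_sub_pow] at h1
    simp only [Nat.sub_self, pow_zero, nsmul_eq_mul, mul_one, eval_natCast,
      Nat.descFactorial_self] at h1
    refine (mul_eq_zero.1 h1).resolve_right ?_
    exact Complex.ofReal_ne_zero.2 (by positivity)
  · intro i hi hij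
    rw [Finset.mem_Icc] at hi
    rw [iterate_derivative_X_sub_pow]
    rcases lt_or_gt_of_ne hij with hlt | hgt
    · have : j - 1 - (i - 1) ≠ 0 := by omega
      simp [this]
    · rw [Nat.descFactorial_of_lt (by omega)]
      simp
  · intro h'
    exact absurd (Finset.mem_Icc.2 ⟨hj1, hjn⟩) h'

open Polynomial in
lemma sesq_tendsto (α β : ℝ) {n : ℕ} (f : ℝ → ℂ) (l : Filter ℝ) (e : ℝ)
    (hle : l ≤ 𝓝 e) (he : e ^ 2 = 1) (hI : Ioo (-1 : ℝ) 1 ∈ l) (γ : ℕ → ℕ → ℂ)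
    (hγ : ∀ k ≤ n, ∀ m ≤ k, m < n → Tendsto (Gf α β f k m) l (𝓝 (γ k m))) (P : ℝ[X]) :
    Tendsto (sesq α β n f (fun x : ℝ => ((P.eval x : ℝ) : ℂ))) l
      (𝓝 (-∑ j ∈ Finset.Icc 1 n, (∑ k ∈ Finset.Icc j n, (-1 : ℂ) ^ (k + j) * γ k (k - j))
        * (((derivative^[j - 1] P).eval e : ℝ) : ℂ))) := by
  have hpoly : ∀ Q : ℝ[X], Tendsto (fun x : ℝ => ((Q.eval x : ℝ) : ℂ)) l
      (𝓝 ((Q.eval e : ℝ) : ℂ)) := fun Q =>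
    ((Complex.continuous_ofReal.comp Q.continuous).tendsto e).mono_left hle
  have main : Tendsto (sesq α β n f (fun x : ℝ => ((P.eval x : ℝ) : ℂ))) l
      (𝓝 (∑ k ∈ Finset.Icc 1 n, ∑ j ∈ Finset.Icc 1 k, (-1 : ℂ) ^ (k + j) *
        (0 - γ k (k - j) * (((derivative^[j - 1] P).eval e : ℝ) : ℂ)))) := by
    unfold sesq
    refine tendsto_finsetSum _ fun k hk => tendsto_finsetSum _ fun j hj => ?_
    rw [Finset.mem_Icc] at hk hj
    refine Tendsto.const_mul _ (Tendsto.sub ?_ (Tendsto.mul ?_ ?_))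
    · rw [iteratedDeriv_poly]
      obtain ⟨Q, hQ⟩ := iteratedDeriv_ak_poly α β (derivative^[k] P) k (k - j) (by omega)
      obtain ⟨i, rfl⟩ : ∃ i, j = i + 1 := ⟨j - 1, by omega⟩
      have h1 := ((hpoly (1 - X ^ 2)).mul (hpoly Q)).mul
        (hγ i (by omega) 0 (by omega) (by omega))
      have e0 : ((eval e (1 - X ^ 2 : ℝ[X]) : ℝ) : ℂ) = 0 := by
        simp only [eval_sub, eval_one, eval_pow, eval_X, he, sub_self, Complex.ofReal_zero]
      rw [e0, zero_mul, zero_mul] at h1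
      refine h1.congr' ?_
      filter_upwards [hI] with x hx
      rw [hQ x hx, show k - (k - (i + 1)) = i + 1 by omega, ak_succ α β i hx]
      unfold Gf
      simp only [iteratedDeriv_zero, Nat.add_sub_cancel, eval_sub, eval_one, eval_pow, eval_X]
      push_cast
      ring
    · exact hγ k hk.2 (k - j) (by omega) (by omega)
    · rw [iteratedDeriv_poly]
      exact hpoly _
  convert main using 2
  rw [← Finset.sum_neg_distrib]
  rw [Finset.sum_comm' (t' := Finset.Icc 1 n) (s' := fun j => Finset.Icc j n)
    (by intro x y; simp only [Finset.mem_Icc]; omega)]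
  refine Finset.sum_congr rfl fun j _ => ?_
  rw [Finset.sum_mul, ← Finset.sum_neg_distrib]
  refine Finset.sum_congr rfl fun k _ => ?_
  ring

lemma endpoint_equiv (α β : ℝ) (hα : 0 < α) (hβ : 0 < β) {n : ℕ} (f : ℝ → ℂ) (l : Filter ℝ)
    [l.NeBot] (e : ℝ) (hle : l ≤ 𝓝 e) (he : e ^ 2 = 1) (hI : Ioo (-1 : ℝ) 1 ∈ l)
    (γ : ℕ → ℕ → ℂ)
    (hγ : ∀ k ≤ n, ∀ m ≤ k, m < n → Tendsto (Gf α β f k m) l (𝓝 (γ k m)))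
    (E c : ℕ → ℕ → ℂ)
    (hrec : ∀ k < n, ∀ m ≤ k, γ (k + 1) m = E k m * γ k m + c k m * γ k (m - 1))
    (hE : ∀ k m, m ≤ k → E k m ≠ 0) (hc : ∀ k, c k 0 = 0) :
    (∀ j < n, Tendsto (sesq α β n f (fun x : ℝ => ((jacobiP α β j x : ℝ) : ℂ))) l (𝓝 0)) ↔
    (∀ j : ℕ, 1 ≤ j → j ≤ n → Tendsto (fun x : ℝ =>
      iteratedDeriv (j - 1) (fun y => ((ak α β j y : ℝ) : ℂ) * iteratedDeriv j f y) x)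
        l (𝓝 0)) := by
  simp only [← JP_eval]
  have hs := fun i => sesq_tendsto α β f l e hle he hI γ hγ (JP α β i)
  constructor
  · intro hB
    have h1 := functional_zero α β hα hβ n e
      (fun j => ∑ k ∈ Finset.Icc j n, (-1 : ℂ) ^ (k + j) * γ k (k - j)) (fun i hi =>
        neg_eq_zero.1 (tendsto_nhds_unique (hs i) (hB i hi)))
    have h2 := alg_B hrec hE hc h1
    intro j hj1 hjn
    have h3 := hγ j hjn (j - 1) (by omega) (by omega)
    rw [h2 (j - 1) j hjn (by omega)] at h3
    exact h3
  · intro hF j hj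
    have h2 := alg_F hrec (fun k hk1 hkn =>
      tendsto_nhds_unique (hγ k hkn (k - 1) (by omega) (by omega)) (hF k hk1 hkn))
    have h3 := hs j
    have e0 : ∀ i ∈ Finset.Icc 1 n,
        (∑ k ∈ Finset.Icc i n, (-1 : ℂ) ^ (k + i) * γ k (k - i))
          * (((Polynomial.derivative^[i - 1] (JP α β j)).eval e : ℝ) : ℂ) = 0 := by
      intro i hi
      rw [Finset.sum_eq_zero, zero_mul]
      intro k hk
      rw [Finset.mem_Icc] at hi hk
      rw [h2 k hk.2 (k - i) (by omega), mul_zero]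
    rw [Finset.sum_eq_zero e0, neg_zero] at h3
    exact h3

/-- The GKN description
`B_n = { f ∈ D_max^{J,n} : [f,P_j^{(α,β)}]_n(±1) = 0 for j = 0,…,n-1 }`
of the left-definite domain coincides with the non-GKN description
`F_n = { f ∈ D_max^{J,n} : ((1-x)^{α+j}(1+x)^{β+j} f^{(j)})^{(j-1)} → 0 at ±1 for
j = 1,…,n }`. -/
theorem jacobi_left_definite_B_eq_F (α β : ℝ)
    (hα0 : 0 < α) (hα1 : α < 1) (hβ0 : 0 < β) (hβ1 : β < 1) (n : ℕ) (hn : 1 ≤ n) :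
    {f : ℝ → ℂ | JacobiMaxDom α β n f ∧ ∀ j < n,
        Tendsto (sesq α β n f (fun x : ℝ => ((jacobiP α β j x : ℝ) : ℂ)))
          (𝓝[<] (1 : ℝ)) (𝓝 0) ∧
        Tendsto (sesq α β n f (fun x : ℝ => ((jacobiP α β j x : ℝ) : ℂ)))
          (𝓝[>] (-1 : ℝ)) (𝓝 0)} =
    {f : ℝ → ℂ | JacobiMaxDom α β n f ∧ ∀ j : ℕ, 1 ≤ j → j ≤ n →
        Tendsto (fun x : ℝ =>
            iteratedDeriv (j - 1) (fun y => ((ak α β j y : ℝ) : ℂ) * iteratedDeriv j f y) x)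
          (𝓝[<] (1 : ℝ)) (𝓝 0) ∧
        Tendsto (fun x : ℝ =>
            iteratedDeriv (j - 1) (fun y => ((ak α β j y : ℝ) : ℂ) * iteratedDeriv j f y) x)
          (𝓝[>] (-1 : ℝ)) (𝓝 0)} := by
  ext f
  simp only [mem_ofPred_eq]
  refine and_congr_right fun hdom => ?_
  have S := jsys_of_maxDom hα0 hβ0 hdom
  obtain ⟨γ, g1, g2⟩ := S.limits hα0
  obtain ⟨δ, d1, d2⟩ := S.limits_left hβ0
  have hright := endpoint_equiv α β hα0 hβ0 f (𝓝[<] (1 : ℝ)) 1 nhdsWithin_le_nhds (by norm_num)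
    (Ioo_mem_nhdsLT (by norm_num)) γ g1 _ _ g2
    (by
      intro k m hm
      have hm' : (m : ℝ) ≤ k := by exact_mod_cast hm
      rw [Complex.ofReal_ne_zero]
      have : 0 < α + k - m := by linarith
      positivity)
    (by intro k; simp)
  have hleft := endpoint_equiv α β hα0 hβ0 f (𝓝[>] (-1 : ℝ)) (-1) nhdsWithin_le_nhds
    (by norm_num) (Ioo_mem_nhdsGT (by norm_num)) δ d1 _ _ d2
    (by
      intro k m hm
      have hm' : (m : ℝ) ≤ k := by exact_mod_cast hm
      rw [Complex.ofReal_ne_zero, neg_ne_zero]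
      have : 0 < β + k - m := by linarith
      positivity)
    (by intro k; simp)
  constructor
  · intro h j hj1 hjn
    exact ⟨hright.1 (fun j hj => (h j hj).1) j hj1 hjn,
      hleft.1 (fun j hj => (h j hj).2) j hj1 hjn⟩
  · intro h j hj
    exact ⟨hright.2 (fun j h1 h2 => (h j h1 h2).1) j hj,
      hleft.2 (fun j h1 h2 => (h j h1 h2).2) j hj⟩
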